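/- arXiv:2312.16515 — 2 statements merged into one kernel-verified Lean document; each statement's English description precedes it below -/
import Mathlib

section
/- For every Borel probability measure μ on ℝ^N there exists a quantile process Q : (0,1)^N → ℝ^N, i.e. a Borel triangular map satisfying the monotonicity condition (inc) and the consistency condition (con), such that the pushforward of the N-fold Lebesgue measure λ^N under Q equals μ. Moreover Q is λ^N-almost surely unique: any two quantile processes pushing λ^N to μ coincide λ^N-almost everywhere. -/
open MeasureTheory ProbabilityTheory Filter Set
open scoped ENNReal NNReal Topology

/-- Lebesgue measure on `(0,1)`. -/
noncomputable def lambda01 : Measure ℝ := volume.restrict (Set.Ioo (0:ℝ) 1)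

/-- The `N`-fold product of Lebesgue measure on `(0,1)`. -/
noncomputable def lambdaN (N : ℕ) : Measure (Fin N → ℝ) :=
  Measure.pi fun _ => lambda01

/-- The open unit cube `(0,1)^N`. -/
def cube (N : ℕ) : Set (Fin N → ℝ) := {u | ∀ i, u i ∈ Set.Ioo (0:ℝ) 1}

/-- A map is triangular (adapted) if its `k`-th component depends only on the first `k`
coordinates. -/
def Triangular {N : ℕ} (Q : (Fin N → ℝ) → Fin N → ℝ) : Prop :=
  ∀ (k : Fin N) (u v : Fin N → ℝ), (∀ j ≤ k, u j = v j) → Q u k = Q v k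

/-- Monotonicity condition (inc) on a set `s`: the `k`-th component is increasing in the
`k`-th coordinate (the earlier coordinates being fixed). -/
def IncOn {N : ℕ} (Q : (Fin N → ℝ) → Fin N → ℝ) (s : Set (Fin N → ℝ)) : Prop :=
  ∀ k : Fin N, ∀ u ∈ s, ∀ v ∈ s, (∀ j < k, u j = v j) → u k ≤ v k → Q u k ≤ Q v k

/-- Strict monotonicity condition (sinc) on a set `s`. -/
def StrictIncOn {N : ℕ} (Q : (Fin N → ℝ) → Fin N → ℝ) (s : Set (Fin N → ℝ)) : Prop :=
  ∀ k : Fin N, ∀ u ∈ s, ∀ v ∈ s, (∀ j < k, u j = v j) → u k < v k → Q u k < Q v k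

/-- Consistency condition (con) on a set `s`: if changing only the `k`-th coordinate does not
change the `k`-th component, then it does not change any later component `m ≥ k`. -/
def ConOn {N : ℕ} (Q : (Fin N → ℝ) → Fin N → ℝ) (s : Set (Fin N → ℝ)) : Prop :=
  ∀ k m : Fin N, k ≤ m → ∀ u ∈ s, ∀ v ∈ s, (∀ j ≠ k, u j = v j) →
    Q u k = Q v k → Q u m = Q v m

/-- A quantile process: a Borel triangular map satisfying (inc) and (con) on the unit cube. -/
structure IsQuantileProcess {N : ℕ} (Q : (Fin N → ℝ) → Fin N → ℝ) : Prop where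
  measurable : Measurable Q
  triangular : Triangular Q
  inc : IncOn Q (cube N)
  con : ConOn Q (cube N)

/-- The (a.e. unique) quantile process of `μ`, chosen via Hilbert's epsilon operator. -/
noncomputable def quantileProcess {N : ℕ} (μ : Measure (Fin N → ℝ)) :
    (Fin N → ℝ) → Fin N → ℝ :=
  Classical.epsilon fun Q => IsQuantileProcess Q ∧ (lambdaN N).map Q = μ

/-- The quantile function of `ν`, the generalized inverse of its distribution function. -/
noncomputable def quantileFun (ν : Measure ℝ) (s : ℝ) : ℝ := sInf {y | s ≤ cdf ν y}

lemma quantileFun_le_iff (ν : Measure ℝ) {s : ℝ} (hs : s ∈ Ioo (0 : ℝ) 1) (y : ℝ) :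
    quantileFun ν s ≤ y ↔ s ≤ cdf ν y := by
  have hbdd : BddBelow {y | s ≤ cdf ν y} := by
    obtain ⟨z, hz⟩ := ((tendsto_cdf_atBot ν).eventually_lt_const hs.1).exists
    refine ⟨z, fun y hy => ?_⟩
    by_contra! h
    exact (hy.trans (monotone_cdf ν h.le)).not_gt hz
  have hne : {y | s ≤ cdf ν y}.Nonempty :=
    (((tendsto_cdf_atTop ν).eventually_const_lt hs.2).exists).imp fun _ h => h.le
  refine ⟨fun h => ?_, fun h => csInf_le hbdd h⟩
  refine le_trans ?_ (monotone_cdf ν h)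
  refine ge_of_tendsto (((cdf ν).right_continuous _).tendsto.mono_left
    (nhdsWithin_mono _ Ioi_subset_Ici_self)) ?_
  filter_upwards [self_mem_nhdsWithin] with z hz
  obtain ⟨w, hw, hwz⟩ := exists_lt_of_csInf_lt hne hz
  exact le_trans hw (monotone_cdf ν hwz.le)

lemma monotoneOn_quantileFun (ν : Measure ℝ) : MonotoneOn (quantileFun ν) (Ioo 0 1) :=
  fun _ hs _ ht hst => (quantileFun_le_iff ν hs _).2
    (hst.trans ((quantileFun_le_iff ν ht _).1 le_rfl))

lemma measurable_quantileFun_kernel {X : Type*} [MeasurableSpace X] (κ : Kernel X ℝ)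
    [IsMarkovKernel κ] :
    Measurable fun p : X × ℝ => (Ioo (0 : ℝ) 1).indicator (quantileFun (κ p.1)) p.2 := by
  refine measurable_of_Iic fun y => ?_
  have hset : (fun p : X × ℝ => (Ioo (0 : ℝ) 1).indicator (quantileFun (κ p.1)) p.2) ⁻¹' Iic y
      = (Prod.snd ⁻¹' Ioo (0 : ℝ) 1 ∩ {p | p.2 ≤ (κ p.1).real (Iic y)})
        ∪ ((Prod.snd ⁻¹' Ioo (0 : ℝ) 1)ᶜ ∩ {_p | 0 ≤ y}) := by
    ext ⟨x, s⟩
    by_cases hs : s ∈ Ioo (0 : ℝ) 1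
    · simp [hs.1, hs.2, quantileFun_le_iff _ hs, cdf_eq_real]
    · simp only [mem_preimage, indicator_of_notMem hs, mem_Iic, mem_union, mem_inter_iff, hs,
        mem_compl_iff, false_and, not_false_eq_true, true_and, false_or, mem_ofPred_eq]
  rw [hset]
  have hI : MeasurableSet (Prod.snd ⁻¹' Ioo (0 : ℝ) 1 : Set (X × ℝ)) :=
    measurable_snd measurableSet_Ioo
  have hF : Measurable fun p : X × ℝ => (κ p.1).real (Iic y) :=
    ((κ.measurable_coe measurableSet_Iic).comp measurable_fst).ennreal_toReal
  exact (hI.inter (measurableSet_le measurable_snd hF)).union (hI.compl.inter (.const _))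

instance : IsProbabilityMeasure lambda01 := ⟨by simp [lambda01]⟩

instance (N : ℕ) : IsProbabilityMeasure (lambdaN N) := by unfold lambdaN; infer_instance

lemma ae_lambda01_mem : ∀ᵐ s ∂lambda01, s ∈ Ioo (0 : ℝ) 1 := ae_restrict_mem measurableSet_Ioo

lemma ae_lambdaN_mem_cube (N : ℕ) : ∀ᵐ u ∂lambdaN N, u ∈ cube N :=
  eventually_countable_forall.2 fun i =>
    (Measure.tendsto_eval_ae_ae (μ := fun _ : Fin N => lambda01) (i := i)).eventually
      ae_lambda01_mem

lemma measurableSet_cube (N : ℕ) : MeasurableSet (cube N) := by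
  have : cube N = univ.pi fun _ => Ioo (0 : ℝ) 1 := by ext; simp [cube]
  rw [this]
  exact .pi countable_univ fun _ _ => measurableSet_Ioo

lemma lambda01_map_quantileFun (ν : Measure ℝ) [IsProbabilityMeasure ν]
    (hm : Measurable ((Ioo (0 : ℝ) 1).indicator (quantileFun ν))) :
    lambda01.map ((Ioo (0 : ℝ) 1).indicator (quantileFun ν)) = ν := by
  have := Measure.isProbabilityMeasure_map (μ := lambda01) hm.aemeasurable
  refine Measure.ext_of_Iic _ _ fun y => ?_
  rw [Measure.map_apply hm measurableSet_Iic, lambda01,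
    Measure.restrict_apply (hm measurableSet_Iic), ← ofReal_cdf ν y]
  have h : (Ioo (0 : ℝ) 1).indicator (quantileFun ν) ⁻¹' Iic y ∩ Ioo 0 1
      = Iic (cdf ν y) ∩ Ioo 0 1 := by
    ext s
    refine and_congr_left fun hs => ?_
    rw [mem_preimage, indicator_of_mem hs, mem_Iic, quantileFun_le_iff _ hs, mem_Iic]
  have h0 := cdf_nonneg ν y
  have h1 := cdf_le_one ν y
  rw [h]
  refine le_antisymm ?_ ?_
  · calc volume (Iic (cdf ν y) ∩ Ioo 0 1) ≤ volume (Ioc 0 (cdf ν y)) :=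
        measure_mono fun s hs => ⟨hs.2.1, hs.1⟩
      _ = _ := by simp
  · calc ENNReal.ofReal (cdf ν y) = volume (Ioo 0 (cdf ν y)) := by simp
      _ ≤ volume (Iic (cdf ν y) ∩ Ioo 0 1) :=
        measure_mono fun s hs => ⟨hs.2.le, hs.1, hs.2.trans_le h1⟩

/-- Splitting off the last coordinate. -/
def splitLast (N : ℕ) (u : Fin (N + 1) → ℝ) : (Fin N → ℝ) × ℝ := (Fin.init u, u (Fin.last N))

/-- Appending a last coordinate. -/
def joinLast (N : ℕ) (p : (Fin N → ℝ) × ℝ) : Fin (N + 1) → ℝ := Fin.snoc p.1 p.2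

@[simp] lemma joinLast_splitLast {N : ℕ} (u : Fin (N + 1) → ℝ) :
    joinLast N (splitLast N u) = u := Fin.snoc_init_self u

@[simp] lemma splitLast_joinLast {N : ℕ} (p : (Fin N → ℝ) × ℝ) :
    splitLast N (joinLast N p) = p := by simp [splitLast, joinLast]

@[simp] lemma joinLast_castSucc {N : ℕ} (p : (Fin N → ℝ) × ℝ) (i : Fin N) :
    joinLast N p i.castSucc = p.1 i := by simp [joinLast]

@[simp] lemma joinLast_last {N : ℕ} (p : (Fin N → ℝ) × ℝ) :
    joinLast N p (Fin.last N) = p.2 := by simp [joinLast]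

lemma measurable_init (N : ℕ) : Measurable fun u : Fin (N + 1) → ℝ => (Fin.init u : Fin N → ℝ) :=
  measurable_pi_iff.2 fun i => measurable_pi_apply i.castSucc

lemma measurable_splitLast (N : ℕ) : Measurable (splitLast N) :=
  (measurable_init N).prodMk (measurable_pi_apply _)

lemma measurable_joinLast (N : ℕ) : Measurable (joinLast N) := by
  refine measurable_pi_iff.2 fun i => ?_
  cases i using Fin.lastCases with
  | last => simpa using measurable_snd
  | cast i => simpa [Function.comp_def] using (measurable_pi_apply i).comp measurable_fst

lemma lambdaN_map_splitLast (N : ℕ) :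
    (lambdaN (N + 1)).map (splitLast N) = (lambdaN N).prod lambda01 := by
  have h := (Measure.measurePreserving_swap (μ := lambda01) (ν := lambdaN N)).comp
    (measurePreserving_piFinSuccAbove (fun _ : Fin (N + 1) => lambda01) (Fin.last N))
  rw [lambdaN]
  convert h.map_eq using 2
  funext u
  refine Prod.ext (funext fun i => ?_) ?_
  · simp [splitLast, MeasurableEquiv.piFinSuccAbove, Fin.init]
  · simp [splitLast, MeasurableEquiv.piFinSuccAbove]

lemma lambdaN_map_joinLast (N : ℕ) :
    ((lambdaN N).prod lambda01).map (joinLast N) = lambdaN (N + 1) := by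
  rw [← lambdaN_map_splitLast, Measure.map_map (measurable_joinLast N) (measurable_splitLast N)]
  convert Measure.map_id
  funext u
  simp

lemma joinLast_mem_cube {N : ℕ} {v : Fin N → ℝ} {s : ℝ} (hv : v ∈ cube N)
    (hs : s ∈ Ioo (0 : ℝ) 1) : joinLast N (v, s) ∈ cube (N + 1) := fun i => by
  cases i using Fin.lastCases with
  | last => simpa using hs
  | cast i => simpa using hv i

/-- Existence of a quantile process representing `μ`. -/
lemma exists_quantileProcess (N : ℕ) (μ : Measure (Fin N → ℝ)) [IsProbabilityMeasure μ] :
    ∃ Q : (Fin N → ℝ) → Fin N → ℝ, IsQuantileProcess Q ∧ (lambdaN N).map Q = μ := by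
  induction N with
  | zero =>
    refine ⟨id, ⟨measurable_id, fun k => k.elim0, fun k => k.elim0, fun k => k.elim0⟩, ?_⟩
    rw [Measure.map_id]
    refine Measure.ext fun s _ => ?_
    rcases s.eq_empty_or_nonempty with rfl | hs
    · simp
    · rw [Subsingleton.eq_univ_of_nonempty hs]; simp
  | succ N ih =>
    let ρ := μ.map (splitLast N)
    have : IsProbabilityMeasure ρ :=
      Measure.isProbabilityMeasure_map (measurable_splitLast N).aemeasurable
    obtain ⟨P, hP, hPρ⟩ := ih ρ.fst
    let κ := ρ.condKernel
    let q : (Fin N → ℝ) × ℝ → ℝ := fun p =>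
      (Ioo (0 : ℝ) 1).indicator (quantileFun (κ p.1)) p.2
    have hq : Measurable q := measurable_quantileFun_kernel κ
    let R : (Fin N → ℝ) × ℝ → (Fin N → ℝ) × ℝ := fun p => (p.1, q p)
    have hR : Measurable R := measurable_fst.prodMk hq
    have hRρ : (ρ.fst.prod lambda01).map R = ρ := by
      conv_rhs => rw [← ρ.disintegrate κ]
      refine Measure.ext fun S hS => ?_
      rw [Measure.map_apply hR hS, Measure.prod_apply (hR hS), Measure.compProd_apply hS]
      refine lintegral_congr fun x => ?_
      have hqx : Measurable ((Ioo (0 : ℝ) 1).indicator (quantileFun (κ x))) :=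
        hq.comp measurable_prodMk_left
      conv_rhs => rw [← lambda01_map_quantileFun (κ x) hqx,
        Measure.map_apply hqx (measurable_prodMk_left hS)]
      rfl
    have hT : Measurable (R ∘ Prod.map P id) := hR.comp (hP.measurable.prodMap measurable_id)
    let Q := joinLast N ∘ (R ∘ Prod.map P id) ∘ splitLast N
    have hQm : Measurable Q := (measurable_joinLast N).comp (hT.comp (measurable_splitLast N))
    have hQc : ∀ u i, Q u (Fin.castSucc i) = P (Fin.init u) i := fun u i => by
      simp [Q, R, splitLast]
    have hQl : ∀ u, Q u (Fin.last N) = q (P (Fin.init u), u (Fin.last N)) := fun u => by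
      simp [Q, R, splitLast]
    have hinit : ∀ u ∈ cube (N + 1), (Fin.init u : Fin N → ℝ) ∈ cube N :=
      fun u hu i => hu i.castSucc
    refine ⟨Q, ⟨hQm, ?_, ?_, ?_⟩, ?_⟩
    · intro k u v h
      cases k using Fin.lastCases with
      | last =>
        have : u = v := funext fun j => h j (Fin.le_last j)
        rw [this]
      | cast k =>
        rw [hQc, hQc]
        exact hP.triangular k _ _ fun j hj => h _ (by simpa using hj)
    · intro k u hu v hv h huv
      cases k using Fin.lastCases with
      | last =>
        have : (Fin.init u : Fin N → ℝ) = Fin.init v :=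
          funext fun j => h _ (Fin.castSucc_lt_last j)
        rw [hQl, hQl, this]
        simp only [q, indicator_of_mem (hu (Fin.last N)), indicator_of_mem (hv (Fin.last N))]
        exact monotoneOn_quantileFun _ (hu _) (hv _) huv
      | cast k =>
        rw [hQc, hQc]
        exact hP.inc k _ (hinit u hu) _ (hinit v hv) (fun j hj => h _ (by simpa using hj)) huv
    · intro k m hkm u hu v hv h huv
      cases k using Fin.lastCases with
      | last => rwa [Fin.last_le_iff.1 hkm]
      | cast k =>
        rw [hQc, hQc] at huv
        have hj : ∀ j ≠ k, (Fin.init u : Fin N → ℝ) j = (Fin.init v : Fin N → ℝ) j :=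
          fun j hj => h _ (by simpa using hj)
        have hPuv : P (Fin.init u) = P (Fin.init v) := by
          funext m
          rcases le_or_gt k m with hm | hm
          · exact hP.con k m hm _ (hinit u hu) _ (hinit v hv) hj huv
          · exact hP.triangular m _ _ fun j hjm => hj j (hjm.trans_lt hm).ne
        cases m using Fin.lastCases with
        | last => rw [hQl, hQl, hPuv, h _ (Fin.castSucc_lt_last k).ne']
        | cast m => rw [hQc, hQc, hPuv]
    · have hmap : ((lambdaN N).prod lambda01).map (R ∘ Prod.map P id) = ρ := by
        rw [← Measure.map_map hR (hP.measurable.prodMap measurable_id),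
          ← Measure.map_prod_map _ _ hP.measurable measurable_id, hPρ, Measure.map_id, hRρ]
      calc (lambdaN (N + 1)).map Q
          = (((lambdaN (N + 1)).map (splitLast N)).map (R ∘ Prod.map P id)).map (joinLast N) := by
            rw [Measure.map_map hT (measurable_splitLast N),
              Measure.map_map (measurable_joinLast N) (hT.comp (measurable_splitLast N))]
        _ = ρ.map (joinLast N) := by rw [lambdaN_map_splitLast, hmap]
        _ = μ := by
            rw [Measure.map_map (measurable_joinLast N) (measurable_splitLast N)]
            convert Measure.map_id
            funext u
            simp

/-- A measurable function that is constant on the fibres of a measurable map `f` factors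
measurably through `f`. -/
lemma exists_measurable_eq_comp_of_fiber_const {X Z β : Type*} [MeasurableSpace X]
    [StandardBorelSpace X] [MeasurableSpace Z] [MeasurableSpace.CountablySeparated Z]
    [MeasurableSpace β] [StandardBorelSpace β] [Nonempty β] {C : Set X} (hC : MeasurableSet C)
    {f : X → Z} (hf : Measurable f) {g : X → β} (hg : Measurable g)
    (hfg : ∀ x ∈ C, ∀ y ∈ C, f x = f y → g x = g y) :
    ∃ α : Z → β, Measurable α ∧ ∀ x ∈ C, g x = α (f x) := by
  have : StandardBorelSpace C := hC.standardBorel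
  have hfC : Measurable (f ∘ ((↑) : C → X)) := hf.comp measurable_subtype_coe
  have hgC : Measurable (g ∘ ((↑) : C → X)) := hg.comp measurable_subtype_coe
  have hfac : Function.FactorsThrough (g ∘ ((↑) : C → X)) (f ∘ ((↑) : C → X)) :=
    fun x y h => hfg x x.2 y y.2 h
  obtain ⟨G, hG⟩ := (Function.factorsThrough_iff _).1 hfac
  have : MeasurableSpace.CountablySeparated (range (f ∘ ((↑) : C → X))) :=
    MeasurableSpace.Subtype.countablySeparated
  rw [hG, hfC.measurable_comp_iff_restrict] at hgC
  obtain ⟨α, hα, hGα⟩ := hgC.exists_eq_measurable_comp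
  refine ⟨α, hα, fun x hx => ?_⟩
  exact (congrFun hG ⟨x, hx⟩).trans (congrFun hGα ⟨f x, ⟨x, hx⟩, rfl⟩)

/-- Functions that are monotone on `(0,1)` with the same distribution are almost everywhere
equal. -/
lemma ae_eq_of_monotoneOn_of_measure_le_eq {a b : ℝ → ℝ} (ha : MonotoneOn a (Ioo 0 1))
    (hb : MonotoneOn b (Ioo 0 1)) (hma : Measurable a) (hmb : Measurable b)
    (h : ∀ y : ℚ, lambda01 {s | a s ≤ y} = lambda01 {s | b s ≤ y}) : a =ᵐ[lambda01] b := by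
  have hae : ∀ y : ℚ, ∀ᵐ s ∂lambda01, (a s ≤ y ↔ b s ≤ y) := fun y => by
    let S := Ioo (0 : ℝ) 1 ∩ {s | a s ≤ y}
    let T := Ioo (0 : ℝ) 1 ∩ {s | b s ≤ y}
    have hSm : MeasurableSet S := measurableSet_Ioo.inter (hma measurableSet_Iic)
    have hTm : MeasurableSet T := measurableSet_Ioo.inter (hmb measurableSet_Iic)
    have hS : S =ᵐ[lambda01] {s | a s ≤ y} := by
      filter_upwards [ae_lambda01_mem] with s hs
      exact propext (and_iff_right hs)
    have hT : T =ᵐ[lambda01] {s | b s ≤ y} := by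
      filter_upwards [ae_lambda01_mem] with s hs
      exact propext (and_iff_right hs)
    have hST : lambda01 S = lambda01 T := by
      rw [measure_congr hS, measure_congr hT, h]
    have hcomp : S ⊆ T ∨ T ⊆ S := by
      by_contra! hne
      obtain ⟨⟨s, hs, hsT⟩, ⟨t, ht, htS⟩⟩ :=
        And.imp not_subset.1 not_subset.1 hne
      rcases le_total s t with hst | hst
      · exact hsT ⟨hs.1, (hb hs.1 ht.1 hst).trans ht.2⟩
      · exact htS ⟨ht.1, (ha ht.1 hs.1 hst).trans hs.2⟩
    have hEq : S =ᵐ[lambda01] T := by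
      rcases hcomp with hsub | hsub
      · exact ae_eq_of_subset_of_measure_ge hsub hST.ge hSm.nullMeasurableSet
          (measure_ne_top _ _)
      · exact (ae_eq_of_subset_of_measure_ge hsub hST.le hTm.nullMeasurableSet
          (measure_ne_top _ _)).symm
    filter_upwards [hS.symm.trans (hEq.trans hT)] with s hs
    exact iff_of_eq hs
  filter_upwards [ae_all_iff.2 hae] with s hs
  refine le_antisymm ?_ ?_
  · exact le_of_forall_lt_rat_imp_le fun y hy => (hs y).2 hy.le
  · exact le_of_forall_lt_rat_imp_le fun y hy => (hs y).1 hy.le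

/-- The first `N` components of a triangular map on `ℝ^(N+1)`. -/
noncomputable def dropLast {N : ℕ} (Q : (Fin (N + 1) → ℝ) → Fin (N + 1) → ℝ) :
    (Fin N → ℝ) → Fin N → ℝ := fun v => Fin.init (Q (joinLast N (v, 1 / 2)))

lemma Triangular.init_apply_joinLast {N : ℕ} {Q : (Fin (N + 1) → ℝ) → Fin (N + 1) → ℝ}
    (hQ : Triangular Q) (v : Fin N → ℝ) (s : ℝ) :
    (Fin.init (Q (joinLast N (v, s))) : Fin N → ℝ) = dropLast Q v :=
  funext fun i => hQ i.castSucc _ _ fun j hj => by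
    cases j using Fin.lastCases with
    | last => exact absurd hj (Fin.castSucc_lt_last i).not_ge
    | cast j => simp

lemma half_mem_Ioo : (1 / 2 : ℝ) ∈ Ioo (0 : ℝ) 1 := by norm_num

lemma IsQuantileProcess.isQuantileProcess_dropLast {N : ℕ} {Q : (Fin (N + 1) → ℝ) → Fin (N + 1) → ℝ}
    (hQ : IsQuantileProcess Q) : IsQuantileProcess (dropLast Q) where
  measurable := (measurable_init N).comp <| hQ.measurable.comp <|
    (measurable_joinLast N).comp (measurable_id.prodMk measurable_const)
  triangular k u v h := hQ.triangular k.castSucc _ _ fun j hj => by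
    cases j using Fin.lastCases with
    | last => simp
    | cast j => simpa using h j (by simpa using hj)
  inc k u hu v hv h huv := hQ.inc k.castSucc _ (joinLast_mem_cube hu half_mem_Ioo) _
    (joinLast_mem_cube hv half_mem_Ioo) (fun j hj => by
      cases j using Fin.lastCases with
      | last => simp
      | cast j => simpa using h j (by simpa using hj)) (by simpa using huv)
  con k m hkm u hu v hv h huv := hQ.con k.castSucc m.castSucc (by simpa using hkm) _
    (joinLast_mem_cube hu half_mem_Ioo) _ (joinLast_mem_cube hv half_mem_Ioo) (fun j hj => by
      cases j using Fin.lastCases with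
      | last => simp
      | cast j => simpa using h j (by simpa using hj)) huv

/-- If the first `n` values agree and the coordinates from the `n`-th on agree, then all values
agree. -/
lemma IsQuantileProcess.eq_of_eq {N : ℕ} {Q : (Fin N → ℝ) → Fin N → ℝ} (hQ : IsQuantileProcess Q)
    {u w : Fin N → ℝ} (hu : u ∈ cube N) (hw : w ∈ cube N) (n : ℕ)
    (hval : ∀ j : Fin N, (j : ℕ) < n → Q u j = Q w j)
    (hcoord : ∀ j : Fin N, n ≤ j → u j = w j) : Q u = Q w := by
  let z : ℕ → Fin N → ℝ := fun i j => if (j : ℕ) < i then w j else u j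
  have hz : ∀ i, z i ∈ cube N := fun i j => by
    by_cases hj : (j : ℕ) < i
    · simpa [z, hj] using hw j
    · simpa [z, hj] using hu j
  have hstep : ∀ i ≤ n, Q (z i) = Q u := by
    intro i
    induction i with
    | zero => simp [z]
    | succ i ih =>
      intro hi
      rw [← ih (Nat.le_of_succ_le hi)]
      by_cases hiN : i < N
      · let k : Fin N := ⟨i, hiN⟩
        have hne : ∀ j ≠ k, z (i + 1) j = z i j := fun j hj => by
          have : (j : ℕ) ≠ i := fun h => hj (Fin.ext h)
          simp only [z, show (j : ℕ) < i + 1 ↔ (j : ℕ) < i by lia]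
        have hk : Q (z (i + 1)) k = Q (z i) k := by
          rw [ih (Nat.le_of_succ_le hi), hval k hi]
          refine hQ.triangular k _ _ fun j hj => ?_
          have : (j : ℕ) < i + 1 := Nat.lt_succ_of_le hj
          simp [z, this]
        funext m
        rcases le_or_gt k m with hm | hm
        · exact hQ.con k m hm _ (hz _) _ (hz _) hne hk
        · exact hQ.triangular m _ _ fun j hj => hne j (hj.trans_lt hm).ne
      · congr 1
        funext j
        have h1 : (j : ℕ) < i := j.2.trans_le (not_lt.1 hiN)
        simp [z, h1, h1.trans (Nat.lt_succ_self i)]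
  rw [← hstep n le_rfl]
  congr 1
  funext j
  by_cases hj : (j : ℕ) < n
  · simp [z, hj]
  · simpa [z, hj] using hcoord j (not_lt.1 hj)

lemma IsQuantileProcess.apply_joinLast_eq_of_dropLast_eq {N : ℕ}
    {Q : (Fin (N + 1) → ℝ) → Fin (N + 1) → ℝ} (hQ : IsQuantileProcess Q) {v w : Fin N → ℝ}
    (hv : v ∈ cube N) (hw : w ∈ cube N) (hvw : dropLast Q v = dropLast Q w) {s : ℝ}
    (hs : s ∈ Ioo (0 : ℝ) 1) : Q (joinLast N (v, s)) = Q (joinLast N (w, s)) := by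
  refine hQ.eq_of_eq (joinLast_mem_cube hv hs) (joinLast_mem_cube hw hs) N (fun j hj => ?_)
    fun j hj => ?_
  · cases j using Fin.lastCases with
    | last => simp at hj
    | cast j =>
      rw [← hQ.triangular.init_apply_joinLast v s, ← hQ.triangular.init_apply_joinLast w s] at hvw
      exact congrFun hvw j
  · cases j using Fin.lastCases with
    | last => simp
    | cast j => exact absurd hj (by simp)

lemma lambdaN_map_dropLast {N : ℕ} {Q : (Fin (N + 1) → ℝ) → Fin (N + 1) → ℝ}
    (hQ : IsQuantileProcess Q) :
    (lambdaN N).map (dropLast Q) = ((lambdaN (N + 1)).map Q).map Fin.init := by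
  have h : (fun u : Fin (N + 1) → ℝ => (Fin.init u : Fin N → ℝ)) ∘ Q ∘ joinLast N
      = dropLast Q ∘ Prod.fst := funext fun p => hQ.triangular.init_apply_joinLast p.1 p.2
  rw [← lambdaN_map_joinLast, Measure.map_map hQ.measurable (measurable_joinLast N),
    Measure.map_map (measurable_init N) (hQ.measurable.comp (measurable_joinLast N)), h,
    ← Measure.map_map hQ.isQuantileProcess_dropLast.measurable measurable_fst]
  simp

/-- The conditional distribution function of the last component of a quantile process, given the
past coordinates, is a measurable function of the past components, and this function satisfies
the defining identity of the conditional distribution function of the image measure. -/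
lemma IsQuantileProcess.exists_condDistribFun {N : ℕ}
    {Q : (Fin (N + 1) → ℝ) → Fin (N + 1) → ℝ} (hQ : IsQuantileProcess Q)
    {μ : Measure (Fin (N + 1) → ℝ)} (hμ : (lambdaN (N + 1)).map Q = μ) (y : ℝ) :
    ∃ α : (Fin N → ℝ) → ℝ≥0∞, Measurable α ∧
      (∀ v ∈ cube N, lambda01 {s | Q (joinLast N (v, s)) (Fin.last N) ≤ y}
        = α (dropLast Q v)) ∧
      ∀ C, MeasurableSet C → ∫⁻ x in C, α x ∂(μ.map Fin.init)
        = μ {x | (Fin.init x : Fin N → ℝ) ∈ C ∧ x (Fin.last N) ≤ y} := by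
  have hQj : Measurable (Q ∘ joinLast N) := hQ.measurable.comp (measurable_joinLast N)
  have hA : MeasurableSet {p | Q (joinLast N p) (Fin.last N) ≤ y} :=
    measurableSet_le ((measurable_pi_apply _).comp hQj) measurable_const
  have hg : Measurable fun v => lambda01 {s | Q (joinLast N (v, s)) (Fin.last N) ≤ y} :=
    measurable_measure_prodMk_left hA
  have hP := hQ.isQuantileProcess_dropLast.measurable
  obtain ⟨α, hα, hgα⟩ := exists_measurable_eq_comp_of_fiber_const (measurableSet_cube N) hP hg
    fun v hv w hw hvw => measure_congr <| by
      filter_upwards [ae_lambda01_mem] with s hs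
      exact congrArg (fun x : Fin (N + 1) → ℝ => x (Fin.last N) ≤ y)
        (hQ.apply_joinLast_eq_of_dropLast_eq hv hw hvw hs)
  refine ⟨α, hα, hgα, fun C hC => ?_⟩
  have hB : MeasurableSet {x : Fin (N + 1) → ℝ |
      (Fin.init x : Fin N → ℝ) ∈ C ∧ x (Fin.last N) ≤ y} :=
    (measurable_init N hC).inter (measurable_pi_apply _ measurableSet_Iic)
  rw [← hμ, ← lambdaN_map_dropLast hQ, setLIntegral_map hC hα hP,
    ← lambdaN_map_joinLast, Measure.map_map hQ.measurable (measurable_joinLast N),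
    Measure.map_apply hQj hB, Measure.prod_apply (hQj hB), ← lintegral_indicator (hP hC)]
  refine lintegral_congr_ae ?_
  filter_upwards [ae_lambdaN_mem_cube N] with v hv
  by_cases hvC : v ∈ dropLast Q ⁻¹' C
  · rw [indicator_of_mem hvC, ← hgα v hv]
    congr 1
    ext s
    simp only [mem_preimage, mem_ofPred_eq, Function.comp_apply,
      hQ.triangular.init_apply_joinLast, iff_and_self]
    exact fun _ => hvC
  · rw [indicator_of_notMem hvC, eq_comm]
    convert measure_empty (μ := lambda01)
    ext s
    simp only [mem_preimage, mem_ofPred_eq, Function.comp_apply,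
      hQ.triangular.init_apply_joinLast, mem_empty_iff_false, iff_false, not_and]
    exact fun h => absurd h hvC

/-- Almost sure uniqueness of the quantile process representing `μ`. -/
lemma IsQuantileProcess.ae_eq {N : ℕ} {μ : Measure (Fin N → ℝ)}
    {Q Q' : (Fin N → ℝ) → Fin N → ℝ} (hQ : IsQuantileProcess Q) (hQ' : IsQuantileProcess Q')
    (hμ : (lambdaN N).map Q = μ) (hμ' : (lambdaN N).map Q' = μ) : Q =ᵐ[lambdaN N] Q' := by
  induction N with
  | zero => exact .of_forall fun u => Subsingleton.elim _ _
  | succ N ih =>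
    have hPP : dropLast Q =ᵐ[lambdaN N] dropLast Q' :=
      ih hQ.isQuantileProcess_dropLast hQ'.isQuantileProcess_dropLast (lambdaN_map_dropLast hQ)
        (by rw [lambdaN_map_dropLast hQ', hμ', hμ])
    have : IsProbabilityMeasure μ :=
      hμ ▸ Measure.isProbabilityMeasure_map hQ.measurable.aemeasurable
    have : IsProbabilityMeasure (μ.map (Fin.init : _ → Fin N → ℝ)) :=
      Measure.isProbabilityMeasure_map (measurable_init N).aemeasurable
    have hcdf : ∀ᵐ v ∂lambdaN N, ∀ y : ℚ,
        lambda01 {s | Q (joinLast N (v, s)) (Fin.last N) ≤ y}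
          = lambda01 {s | Q' (joinLast N (v, s)) (Fin.last N) ≤ y} := by
      refine ae_all_iff.2 fun y => ?_
      obtain ⟨α, hα, hQα, hint⟩ := hQ.exists_condDistribFun hμ y
      obtain ⟨α', hα', hQα', hint'⟩ := hQ'.exists_condDistribFun hμ' y
      have hαα' : α =ᵐ[μ.map Fin.init] α' :=
        ae_eq_of_forall_setLIntegral_eq_of_sigmaFinite hα hα' fun C hC _ => by
          rw [hint C hC, hint' C hC]
      rw [← hμ, ← lambdaN_map_dropLast hQ] at hαα'
      filter_upwards [ae_of_ae_map hQ.isQuantileProcess_dropLast.measurable.aemeasurable hαα', hPP,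
        ae_lambdaN_mem_cube N] with v h1 h2 h3
      rw [hQα v h3, hQα' v h3, h1, h2]
    have hQj := hQ.measurable.comp (measurable_joinLast N)
    have hQj' := hQ'.measurable.comp (measurable_joinLast N)
    have hlast : ∀ {R : (Fin (N + 1) → ℝ) → Fin (N + 1) → ℝ}, IsQuantileProcess R →
        ∀ v ∈ cube N,
          MonotoneOn (fun s => R (joinLast N (v, s)) (Fin.last N)) (Ioo 0 1) :=
      fun hR v hv s hs t ht hst => hR.inc (Fin.last N) _ (joinLast_mem_cube hv hs) _
        (joinLast_mem_cube hv ht) (fun j hj => by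
          cases j using Fin.lastCases with
          | last => exact absurd hj (lt_irrefl _)
          | cast j => simp) (by simpa using hst)
    rw [← lambdaN_map_joinLast]
    refine (ae_map_iff (measurable_joinLast N).aemeasurable
      (measurableSet_eq_fun hQ.measurable hQ'.measurable)).2 ?_
    refine (Measure.ae_prod_iff_ae_ae (measurableSet_eq_fun hQj hQj')).2 ?_
    filter_upwards [hcdf, hPP, ae_lambdaN_mem_cube N] with v h1 h2 h3
    filter_upwards [ae_eq_of_monotoneOn_of_measure_le_eq (hlast hQ v h3) (hlast hQ' v h3)
      ((measurable_pi_apply _).comp (hQj.comp measurable_prodMk_left))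
      ((measurable_pi_apply _).comp (hQj'.comp measurable_prodMk_left)) h1] with s hs
    funext i
    cases i using Fin.lastCases with
    | last => exact hs
    | cast i =>
      have h := h2
      rw [← hQ.triangular.init_apply_joinLast v s,
        ← hQ'.triangular.init_apply_joinLast v s] at h
      exact congrFun h i

/-- For every Borel probability measure `μ` on `ℝ^N` there exists a quantile
process `Q` with `Q_# λ^N = μ`, and it is `λ^N`-a.s. unique. -/
theorem quantileProcess_existsUnique (N : ℕ) (μ : Measure (Fin N → ℝ))
    [IsProbabilityMeasure μ] :
    (∃ Q : (Fin N → ℝ) → Fin N → ℝ, IsQuantileProcess Q ∧ (lambdaN N).map Q = μ) ∧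
    (∀ Q Q' : (Fin N → ℝ) → Fin N → ℝ, IsQuantileProcess Q → IsQuantileProcess Q' →
      (lambdaN N).map Q = μ → (lambdaN N).map Q' = μ → Q =ᵐ[lambdaN N] Q') := by
  exact ⟨exists_quantileProcess N μ, fun _ _ hQ hQ' h h' => hQ.ae_eq hQ' h h'⟩
end

section
/- Let X and Y be Polish spaces, μ a Borel probability measure on X, and f, g : X → Y Borel measurable maps such that for all x_1, x_2 ∈ X, f(x_1) = f(x_2) implies g(x_1) = g(x_2). Then there exists a Borel measurable function h : Y → X such that g = g ∘ h ∘ f holds μ-almost surely. -/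
open MeasureTheory

/-- A continuous map has a Borel section over the image of a compact set: pick in every fibre
the point minimizing a continuous measurable embedding into the real line. -/
theorem IsCompact.exists_measurable_section {X Y : Type*}
    [TopologicalSpace X] [MeasurableSpace X] [Nonempty X]
    [TopologicalSpace Y] [T2Space Y] [MeasurableSpace Y] [BorelSpace Y]
    {K : Set X} (hK : IsCompact K) {f : X → Y} (hf : Continuous f)
    {e : X → ℝ} (he : Continuous e) (he' : MeasurableEmbedding e) :
    ∃ h : Y → X, Measurable h ∧ ∀ y ∈ f '' K, f (h y) = y := by
  classical
  obtain ⟨x₀⟩ := ‹Nonempty X›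
  have hmin : ∀ y : Y, ∃ x : X, (y ∈ f '' K → x ∈ K ∧ f x = y ∧
      ∀ z ∈ K, f z = y → e x ≤ e z) ∧ (y ∉ f '' K → x = x₀) := by
    intro y
    by_cases hy : y ∈ f '' K
    · have hc : IsCompact (K ∩ f ⁻¹' {y}) := hK.inter_right (isClosed_singleton.preimage hf)
      obtain ⟨x, ⟨hxK, hxy⟩, hx⟩ := hc.exists_isMinOn hy he.continuousOn
      exact ⟨x, fun _ => ⟨hxK, hxy, fun z hz hzy => hx ⟨hz, hzy⟩⟩, fun h => absurd hy h⟩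
    · exact ⟨x₀, fun h => absurd h hy, fun _ => rfl⟩
  choose h hh hh₀ using hmin
  refine ⟨h, he'.measurable_comp_iff.1 (measurable_of_Iic fun c => ?_), fun y hy => (hh y hy).2.1⟩
  have hKm : MeasurableSet (f '' K) := (hK.image hf).isClosed.measurableSet
  have hcm : MeasurableSet (f '' (K ∩ e ⁻¹' Set.Iic c)) :=
    ((hK.inter_right (isClosed_Iic.preimage he)).image hf).isClosed.measurableSet
  have heq : (e ∘ h) ⁻¹' Set.Iic c =
      f '' (K ∩ e ⁻¹' Set.Iic c) ∪ ((f '' K)ᶜ ∩ {_y | e x₀ ≤ c}) := by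
    ext y
    by_cases hy : y ∈ f '' K
    · obtain ⟨hxK, hxy, hx⟩ := hh y hy
      simp only [Set.mem_union, Set.mem_inter_iff, Set.mem_compl_iff, hy, not_true, false_and,
        or_false]
      constructor
      · exact fun hc => ⟨h y, ⟨hxK, hc⟩, hxy⟩
      · rintro ⟨z, ⟨hzK, hzc⟩, hzy⟩
        exact (hx z hzK hzy).trans hzc
    · have hy' : y ∉ f '' (K ∩ e ⁻¹' Set.Iic c) :=
        fun hy' => hy (Set.image_mono Set.inter_subset_left hy')
      simp [hy, hy', hh₀ y hy, -Set.mem_image]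
  rw [heq]
  exact hcm.union (hKm.compl.inter (MeasurableSet.const _))

/-- A continuous map `f` on a Polish space admitting a continuous measurable embedding into the
real line has a Borel right inverse `μ.map f`-almost everywhere, for every finite measure `μ`. -/
theorem Continuous.exists_measurable_ae_section {X Y : Type*} [Nonempty X]
    [TopologicalSpace X] [PolishSpace X] [MeasurableSpace X] [BorelSpace X]
    [TopologicalSpace Y] [T2Space Y] [MeasurableSpace Y] [BorelSpace Y]
    (μ : Measure X) [IsFiniteMeasure μ] {f : X → Y} (hf : Continuous f)
    {e : X → ℝ} (he : Continuous e) (he' : MeasurableEmbedding e) :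
    ∃ h : Y → X, Measurable h ∧ ∀ᵐ x ∂μ, f (h (f x)) = f x := by
  have hK : ∀ n : ℕ, ∃ K : Set X, IsCompact K ∧ μ Kᶜ < ((n : ENNReal) + 1)⁻¹ := by
    intro n
    obtain ⟨K, -, hK, hlt⟩ := MeasurableSet.univ.exists_isCompact_sdiff_lt (μ := μ)
      (measure_ne_top μ _) (ε := ((n : ENNReal) + 1)⁻¹) (by simp)
    exact ⟨K, hK, by rwa [Set.compl_eq_univ_sdiff]⟩
  choose K hKc hKμ using hK
  choose h hm hs using fun n => (hKc n).exists_measurable_section hf he he'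
  have hfK : ∀ n, MeasurableSet (f '' K n) := fun n => ((hKc n).image hf).isClosed.measurableSet
  obtain ⟨s, hsm, hseq⟩ := exists_measurable_piecewise (disjointed fun n => f '' K n)
    (fun n => MeasurableSet.disjointed hfK n) h hm (by
      intro i j hij y hy
      exact (Set.disjoint_left.1 (disjoint_disjointed _ hij) hy.1 hy.2).elim)
  have hnull : μ (⋃ n, K n)ᶜ = 0 := by
    refine le_antisymm (ge_of_tendsto' ENNReal.tendsto_inv_nat_nhds_zero fun n => ?_) zero_le
    refine (measure_mono (Set.compl_subset_compl.2 (Set.subset_iUnion K n))).trans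
      ((hKμ n).le.trans ?_)
    exact ENNReal.inv_le_inv.2 le_self_add
  refine ⟨s, hsm, ?_⟩
  filter_upwards [compl_mem_ae_iff.2 hnull] with x hx
  rw [compl_compl] at hx
  obtain ⟨n, hn⟩ := Set.mem_iUnion.1 hx
  have hmem : f x ∈ ⋃ n, disjointed (fun n => f '' K n) n := by
    rw [iUnion_disjointed]
    exact Set.mem_iUnion.2 ⟨n, Set.mem_image_of_mem f hn⟩
  obtain ⟨m, hxm⟩ := Set.mem_iUnion.1 hmem
  rw [hseq m hxm]
  exact hs m _ (disjointed_subset _ m hxm)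

/-- **Measurable selection, almost everywhere version.** A Borel map `f` between Polish spaces
has a Borel right inverse `μ.map f`-almost everywhere, for every finite measure `μ`. -/
theorem Measurable.exists_measurable_ae_section {X Y : Type*} [Nonempty X]
    [TopologicalSpace X] [PolishSpace X] [MeasurableSpace X] [BorelSpace X]
    [TopologicalSpace Y] [PolishSpace Y] [MeasurableSpace Y] [BorelSpace Y]
    (μ : Measure X) [IsFiniteMeasure μ] {f : X → Y} (hf : Measurable f) :
    ∃ h : Y → X, Measurable h ∧ ∀ᵐ x ∂μ, f (h (f x)) = f x := by
  have hpolX : PolishSpace X := inferInstance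
  have hborX := BorelSpace.measurable_eq (α := X)
  have he := measurableEmbedding_embeddingReal X
  obtain ⟨t, ht, hcont, hpol⟩ := (hf.prodMk he.measurable).exists_continuous
  have hbor : @BorelSpace X t _ :=
    @BorelSpace.mk X t _ (hborX.trans (borel_eq_borel_of_le hpol hpolX ht).symm)
  exact @Continuous.exists_measurable_ae_section X Y _ t hpol _ hbor _ _ _ _ μ _ f
    (@Continuous.fst X Y ℝ t _ _ _ hcont) _ (@Continuous.snd X Y ℝ t _ _ _ hcont) he

/-- If `f, g` are Borel maps between Polish spaces such that `f x₁ = f x₂`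
implies `g x₁ = g x₂`, then there is a Borel map `h : Y → X` with `g = g ∘ h ∘ f` μ-a.s. -/
theorem exists_borel_section (X Y : Type*)
    [TopologicalSpace X] [PolishSpace X] [MeasurableSpace X] [BorelSpace X]
    [TopologicalSpace Y] [PolishSpace Y] [MeasurableSpace Y] [BorelSpace Y]
    (μ : Measure X) [IsProbabilityMeasure μ]
    (f g : X → Y) (hf : Measurable f) (hg : Measurable g)
    (hfg : ∀ x₁ x₂ : X, f x₁ = f x₂ → g x₁ = g x₂) :
    ∃ h : Y → X, Measurable h ∧ g =ᵐ[μ] fun x => g (h (f x)) := by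
  obtain ⟨x₀⟩ := nonempty_of_isProbabilityMeasure μ
  have : Nonempty X := ⟨x₀⟩
  obtain ⟨h, hm, hh⟩ := hf.exists_measurable_ae_section μ
  exact ⟨h, hm, hh.mono fun x hx => (hfg _ _ hx).symm⟩
end
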